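/- Let R be a one-dimensional Cohen-Macaulay semi-local Arf ring and I an ideal of R containing a nonzerodivisor that is reflexive as an R-module. Then I is isomorphic as an R-module to its trace ideal tr_R(I), I is isomorphic as an R-module to its dual Hom_R(I, R), and tr_R(I) is an integrally closed ideal of R. -/

import Mathlib

/-- The trace ideal of an `R`-module `M`: the sum of the images of all
`R`-linear maps `M → R`. -/
def traceIdeal (R : Type*) [CommRing R] (M : Type*) [AddCommGroup M] [Module R M] : Ideal R :=
  ⨆ f : M →ₗ[R] R, LinearMap.range f

/-- `x` is integral over the ideal `I`: there are `n ≥ 1` and `a_i ∈ I^i` with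
`x^n + a_1 x^{n-1} + ... + a_n = 0`. -/
def IsIntegralOverIdeal {R : Type*} [CommRing R] (I : Ideal R) (x : R) : Prop :=
  ∃ n : ℕ, 0 < n ∧ ∃ a : ℕ → R, (∀ i, 1 ≤ i → i ≤ n → a i ∈ I ^ i) ∧
    x ^ n + ∑ i ∈ Finset.Icc 1 n, a i * x ^ (n - i) = 0

/-- An ideal is integrally closed if it contains every element integral over it. -/
def IsIntegrallyClosedIdeal {R : Type*} [CommRing R] (I : Ideal R) : Prop :=
  ∀ x : R, IsIntegralOverIdeal I x → x ∈ I

/-- A ring `R` is an Arf ring if for every integrally closed ideal `I` of `R` containing a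
nonzerodivisor there exists `a ∈ I` with `I² = aI`. -/
def IsArfRing (R : Type*) [CommRing R] : Prop :=
  ∀ I : Ideal R, IsIntegrallyClosedIdeal I → (∃ x ∈ I, x ∈ nonZeroDivisors R) →
    ∃ a ∈ I, I ^ 2 = Ideal.span {a} * I

/-- A one-dimensional Cohen-Macaulay semi-local ring: a commutative Noetherian ring with
finitely many maximal ideals, all of whose localizations at maximal ideals are Noetherian
local rings of Krull dimension one whose maximal ideal contains a nonzerodivisor. -/
def IsOneDimCMSemiLocal (R : Type*) [CommRing R] : Prop :=
  IsNoetherianRing R ∧ {I : Ideal R | I.IsMaximal}.Finite ∧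
  ∀ m : Ideal R, (hm : m.IsMaximal) →
    letI := hm.isPrime
    ringKrullDim (Localization.AtPrime m) = 1 ∧
    ∃ x ∈ IsLocalRing.maximalIdeal (Localization.AtPrime m),
      x ∈ nonZeroDivisors (Localization.AtPrime m)

open scoped nonZeroDivisors

section IntegralClosure

variable {R : Type*} [CommRing R]

/-- A linear form all of whose values are divisible by a nonzerodivisor `a` can be divided by `a`. -/
theorem LinearMap.exists_mul_eq_of_forall_dvd {M : Type*} [AddCommGroup M] [Module R M] {a : R}
    (ha : a ∈ R⁰) (f : M →ₗ[R] R) (hf : ∀ m, a ∣ f m) :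
    ∃ g : M →ₗ[R] R, ∀ m, a * g m = f m := by
  choose g hg using hf
  refine ⟨{ toFun := g, map_add' := fun x y ↦ ?_, map_smul' := fun c x ↦ ?_ },
    fun m ↦ (hg m).symm⟩
  · refine (mul_cancel_left_mem_nonZeroDivisors ha).1 ?_
    rw [← hg, map_add, hg x, hg y, mul_add]
  · refine (mul_cancel_left_mem_nonZeroDivisors ha).1 ?_
    simp only [RingHom.id_apply, smul_eq_mul]
    rw [← hg, map_smul, hg x, smul_eq_mul, mul_left_comm]

theorem Ideal.sup_pow_succ_le (J X : Ideal R) (n : ℕ) :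
    (J ⊔ X) ^ (n + 1) ≤ J * (J ⊔ X) ^ n ⊔ X ^ (n + 1) := by
  induction n with
  | zero => simp
  | succ n ih =>
    calc (J ⊔ X) ^ (n + 1 + 1) = J * (J ⊔ X) ^ (n + 1) ⊔ X * (J ⊔ X) ^ (n + 1) := by
          rw [pow_succ' _ (n + 1), Ideal.sup_mul]
      _ ≤ J * (J ⊔ X) ^ (n + 1) ⊔ X * (J * (J ⊔ X) ^ n ⊔ X ^ (n + 1)) :=
          sup_le_sup_left (Ideal.mul_mono_right ih) _
      _ ≤ J * (J ⊔ X) ^ (n + 1) ⊔ X ^ (n + 1 + 1) := by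
          rw [Ideal.mul_sup, ← pow_succ', mul_left_comm]
          refine sup_le le_sup_left (sup_le (le_sup_of_le_left (Ideal.mul_mono_right ?_))
            le_sup_right)
          rw [pow_succ']
          exact Ideal.mul_mono_left le_sup_right

theorem IsIntegralOverIdeal.exists_span_mul_le {J : Ideal R} {x : R}
    (hx : IsIntegralOverIdeal J x) (hJ : ∃ r ∈ J, r ∈ R⁰) :
    ∃ M : Ideal R, (∃ r ∈ M, r ∈ R⁰) ∧ Ideal.span {x} * M ≤ J * M := by
  obtain ⟨n, hn, c, hc, hsum⟩ := hx
  obtain ⟨r, hr, hr0⟩ := hJ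
  obtain ⟨n, rfl⟩ := Nat.exists_eq_add_of_lt hn
  rw [zero_add] at *
  refine ⟨(J ⊔ Ideal.span {x}) ^ n,
    ⟨r ^ n, Ideal.pow_mem_pow (Ideal.mem_sup_left hr) n, pow_mem hr0 n⟩, ?_⟩
  calc Ideal.span {x} * (J ⊔ Ideal.span {x}) ^ n
      ≤ (J ⊔ Ideal.span {x}) ^ (n + 1) := by
        rw [pow_succ']; exact Ideal.mul_mono_left le_sup_right
    _ ≤ J * (J ⊔ Ideal.span {x}) ^ n ⊔ Ideal.span {x} ^ (n + 1) := Ideal.sup_pow_succ_le _ _ _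
    _ ≤ J * (J ⊔ Ideal.span {x}) ^ n := by
        refine sup_le le_rfl ?_
        rw [Ideal.span_singleton_pow, Ideal.span_singleton_le_iff_mem,
          eq_neg_of_add_eq_zero_left hsum]
        refine neg_mem (sum_mem fun i hi ↦ ?_)
        obtain ⟨h1, h2⟩ := Finset.mem_Icc.1 hi
        obtain ⟨i, rfl⟩ := Nat.exists_eq_add_of_le' h1
        have hle : J ^ (i + 1) * Ideal.span {x} ^ (n - i) ≤ J * (J ⊔ Ideal.span {x}) ^ n := by
          calc _ ≤ J * ((J ⊔ Ideal.span {x}) ^ i * (J ⊔ Ideal.span {x}) ^ (n - i)) := by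
                rw [pow_succ', mul_assoc]
                exact Ideal.mul_mono_right (Ideal.mul_mono (Ideal.pow_right_mono le_sup_left _)
                  (Ideal.pow_right_mono le_sup_right _))
            _ = _ := by rw [← pow_add]; congr 2; omega
        refine hle (Ideal.mul_mem_mul (hc _ h1 h2) ?_)
        rw [show n + 1 - (i + 1) = n - i by omega]
        exact Ideal.pow_mem_pow (Ideal.mem_span_singleton_self x) _

/-- In a Noetherian ring, an ideal `J` containing a nonzerodivisor lies in an integrally closed
ideal `L` over which `J` is a reduction. -/
theorem Ideal.exists_isIntegrallyClosedIdeal_ge [IsNoetherianRing R] {J : Ideal R}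
    (hJ : ∃ r ∈ J, r ∈ R⁰) :
    ∃ L : Ideal R, J ≤ L ∧ IsIntegrallyClosedIdeal L ∧
      ∃ M : Ideal R, (∃ r ∈ M, r ∈ R⁰) ∧ L * M ≤ J * M := by
  let S : Set (Ideal R) := {L | ∃ M : Ideal R, (∃ r ∈ M, r ∈ R⁰) ∧ L * M ≤ J * M}
  have hJS : J ∈ S := ⟨⊤, ⟨1, trivial, one_mem _⟩, le_rfl⟩
  have hsup : ∀ L ∈ S, ∀ L' ∈ S, L ⊔ L' ∈ S := by
    rintro L ⟨M, ⟨r, hr, hr0⟩, hM⟩ L' ⟨M', ⟨r', hr', hr0'⟩, hM'⟩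
    refine ⟨M * M', ⟨r * r', Ideal.mul_mem_mul hr hr', mul_mem hr0 hr0'⟩, ?_⟩
    rw [Ideal.sup_mul]
    refine sup_le ?_ ?_
    · rw [← mul_assoc, ← mul_assoc]
      exact Ideal.mul_mono_left hM
    · rw [mul_left_comm, mul_left_comm J]
      exact Ideal.mul_mono_right hM'
  obtain ⟨L, hLS, hmax⟩ := set_has_maximal_iff_noetherian.2 ‹IsNoetherianRing R› S ⟨J, hJS⟩
  have hle : ∀ L' ∈ S, L' ≤ L := fun L' h' ↦ by
    by_contra h
    exact hmax _ (hsup L hLS L' h') (left_lt_sup.2 h)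
  have hJL := hle J hJS
  refine ⟨L, hJL, fun x hx ↦ ?_, hLS⟩
  obtain ⟨M, ⟨r, hr, hr0⟩, hM⟩ := hLS
  obtain ⟨N, ⟨s, hs, hs0⟩, hN⟩ := hx.exists_span_mul_le (hJ.imp fun _ h ↦ ⟨hJL h.1, h.2⟩)
  refine (Ideal.span_singleton_le_iff_mem L).1 (hle _
    ⟨N * M, ⟨s * r, Ideal.mul_mem_mul hs hr, mul_mem hs0 hr0⟩, ?_⟩)
  calc Ideal.span {x} * (N * M) = Ideal.span {x} * N * M := (mul_assoc ..).symm
    _ ≤ L * N * M := Ideal.mul_mono_left hN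
    _ = N * (L * M) := by ring
    _ ≤ N * (J * M) := Ideal.mul_mono_right hM
    _ = J * (N * M) := by ring

/-- The determinant trick for multiplication by a ring element on an ideal. -/
theorem Ideal.exists_monic_eval_eq_zero_of_span_mul_le [IsNoetherianRing R] {J M : Ideal R} {x : R}
    (hM : ∃ r ∈ M, r ∈ R⁰) (h : Ideal.span {x} * M ≤ J * M) :
    ∃ p : Polynomial R, p.Monic ∧ (∀ k, p.coeff k ∈ J ^ (p.natDegree - k)) ∧ p.eval x = 0 := by
  obtain ⟨r, hr, hr0⟩ := hM
  obtain ⟨p, hp, -, hc, h0⟩ :=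
    LinearMap.exists_monic_and_natDegree_eq_and_coeff_mem_pow_and_aeval_eq_zero R
      (algebraMap R (Module.End R M) x) J (by
        rintro _ ⟨m, rfl⟩
        have hm : x * (m : R) ∈ J • M :=
          h (Ideal.mul_mem_mul (Ideal.mem_span_singleton_self x) m.2)
        have hJM : J • M = Submodule.map M.subtype (J • ⊤) := by
          rw [Submodule.map_smul'', Submodule.map_subtype_top]
        rw [hJM] at hm
        obtain ⟨y, hy, hyx⟩ := hm
        have hxm : algebraMap R (Module.End R M) x m = y := Subtype.ext hyx.symm
        rwa [hxm])
  refine ⟨p, hp, hc, ?_⟩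
  rw [Polynomial.aeval_algebraMap_apply] at h0
  have h1 := congr_arg Subtype.val (LinearMap.congr_fun h0 ⟨r, hr⟩)
  simp only [Polynomial.coe_aeval_eq_eval, Module.algebraMap_end_apply, SetLike.mk_smul_mk,
    smul_eq_mul, LinearMap.zero_apply, ZeroMemClass.coe_zero] at h1
  exact (mem_nonZeroDivisors_iff.1 hr0).2 _ h1

theorem mem_nonZeroDivisors_of_sq_eq_span_mul {L : Ideal R} {a : R} (hL : ∃ r ∈ L, r ∈ R⁰)
    (h : L ^ 2 = Ideal.span {a} * L) : a ∈ R⁰ := by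
  obtain ⟨r, hr, hr0⟩ := hL
  have := Ideal.pow_mem_pow hr 2
  rw [h, Ideal.mem_span_singleton_mul] at this
  obtain ⟨z, -, hz⟩ := this
  have h2 : a * z ∈ R⁰ := hz ▸ pow_mem hr0 2
  exact (mul_mem_nonZeroDivisors.1 h2).1

/-- In a Noetherian Arf ring, an ideal containing a nonzerodivisor and stable under all linear
forms on itself is integrally closed. -/
theorem IsArfRing.isIntegrallyClosedIdeal [IsNoetherianRing R] (hR : IsArfRing R) {J : Ideal R}
    (hJ : ∃ r ∈ J, r ∈ R⁰) (htr : ∀ (f : J →ₗ[R] R) (j : J), f j ∈ J) :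
    IsIntegrallyClosedIdeal J := by
  obtain ⟨L, hJL, hL, M, hM, hLM⟩ := Ideal.exists_isIntegrallyClosedIdeal_ge hJ
  have hLr : ∃ r ∈ L, r ∈ R⁰ := hJ.imp fun _ h ↦ ⟨hJL h.1, h.2⟩
  obtain ⟨a, haL, ha⟩ := hR L hL hLr
  have ha0 := mem_nonZeroDivisors_of_sq_eq_span_mul hLr ha
  have hmul : J * L ≤ Ideal.span {a} * J := by
    refine Ideal.mul_le.2 fun j hj b hb ↦ ?_
    obtain ⟨g, hg⟩ := LinearMap.exists_mul_eq_of_forall_dvd ha0 (b • J.subtype) fun m ↦ by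
      have : b * (m : R) ∈ L ^ 2 := by rw [pow_two]; exact Ideal.mul_mem_mul hb (hJL m.2)
      rw [ha, Ideal.mem_span_singleton_mul] at this
      obtain ⟨z, -, hz⟩ := this
      exact ⟨z, hz.symm⟩
    rw [Ideal.mem_span_singleton_mul]
    exact ⟨g ⟨j, hj⟩, htr g _, by rw [hg]; simp [mul_comm]⟩
  have hpow : ∀ m, J * L ^ m ≤ Ideal.span {a} ^ m * J := fun m ↦ by
    induction m with
    | zero => simp
    | succ m ih =>
      calc J * L ^ (m + 1) = J * L ^ m * L := by rw [pow_succ, mul_assoc]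
        _ ≤ Ideal.span {a} ^ m * J * L := Ideal.mul_mono_left ih
        _ = Ideal.span {a} ^ m * (J * L) := mul_assoc ..
        _ ≤ Ideal.span {a} ^ m * (Ideal.span {a} * J) := Ideal.mul_mono_right hmul
        _ = _ := by rw [pow_succ, mul_assoc]
  have haJ : a ∈ J := by
    obtain ⟨p, hp, hc, h0⟩ := Ideal.exists_monic_eval_eq_zero_of_span_mul_le hM
      ((Ideal.mul_mono_left ((Ideal.span_singleton_le_iff_mem L).2 haL)).trans hLM)
    rw [Polynomial.eval_eq_sum_range, Finset.sum_range_succ, hp.coeff_natDegree, one_mul] at h0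
    obtain hn | ⟨n, hn⟩ : p.natDegree = 0 ∨ ∃ n, p.natDegree = n + 1 :=
      (Nat.eq_zero_or_eq_succ_pred _).imp_right fun h ↦ ⟨_, h⟩
    · simp only [hn, Finset.range_zero, Finset.sum_empty, pow_zero, zero_add] at h0
      rw [← mul_one a, h0, mul_zero]
      exact J.zero_mem
    rw [hn] at h0 hc
    have hmem : a ^ (n + 1) ∈ Ideal.span {a} ^ n * J := by
      rw [eq_neg_of_add_eq_zero_right h0]
      refine neg_mem (sum_mem fun k hk ↦ ?_)
      have hk' : k ≤ n := Nat.lt_succ_iff.1 (Finset.mem_range.1 hk)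
      refine hpow n ?_
      have hle : J ^ (n + 1 - k) * L ^ k ≤ J * L ^ n := by
        rw [Nat.succ_sub hk', pow_succ', mul_assoc]
        refine Ideal.mul_mono_right ((Ideal.mul_mono_left (Ideal.pow_right_mono hJL _)).trans ?_)
        rw [← pow_add, Nat.sub_add_cancel hk']
      exact hle (Ideal.mul_mem_mul (hc k) (Ideal.pow_mem_pow haL k))
    rw [Ideal.span_singleton_pow, Ideal.mem_span_singleton_mul] at hmem
    obtain ⟨z, hz, hza⟩ := hmem
    rw [pow_succ, mul_cancel_left_mem_nonZeroDivisors (pow_mem ha0 n)] at hza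
    exact hza ▸ hz
  have hLJ : L ≤ J := fun b hb ↦ by
    have := hmul (Ideal.mul_mem_mul haJ hb)
    rw [Ideal.mem_span_singleton_mul] at this
    obtain ⟨z, hz, hzb⟩ := this
    rw [mul_cancel_left_mem_nonZeroDivisors ha0] at hzb
    exact hzb ▸ hz
  rwa [le_antisymm hJL hLJ]

end IntegralClosure

section Blowup

theorem Algebra.finite_setOf_isMaximal_of_moduleFinite {R S : Type*} [CommRing R] [CommRing S]
    [Algebra R S] [Module.Finite R S] (h : {m : Ideal R | m.IsMaximal}.Finite) :
    {m : Ideal S | m.IsMaximal}.Finite := by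
  refine (h.biUnion fun m _ ↦ Algebra.QuasiFinite.finite_primesOver (S := S) m).subset fun n hn ↦ ?_
  have : n.IsMaximal := hn
  exact Set.mem_biUnion (Ideal.isMaximal_comap_of_isIntegral_of_isMaximal (R := R) n)
    ⟨this.isPrime, ⟨rfl⟩⟩

variable {R : Type*} [CommRing R]

/-- If `J ^ 2 = a J` with `a ∈ J`, then `a⁻¹ J` is a ring: the blowup of `R` at `J`. -/
def Ideal.blowupSubalgebra (Q : Type*) [CommRing Q] [Algebra R Q] {J : Ideal R} {a : R}
    (hu : IsUnit (algebraMap R Q a)) (haJ : a ∈ J) (ha : J ^ 2 = Ideal.span {a} * J) :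
    Subalgebra R Q where
  carrier := {q | ∃ r ∈ J, algebraMap R Q a * q = algebraMap R Q r}
  mul_mem' := by
    rintro p q ⟨r, hr, hp⟩ ⟨s, hs, hq⟩
    have hrs : r * s ∈ J ^ 2 := by rw [pow_two]; exact Ideal.mul_mem_mul hr hs
    rw [ha, Ideal.mem_span_singleton_mul] at hrs
    obtain ⟨z, hz, hzrs⟩ := hrs
    refine ⟨z, hz, hu.mul_left_cancel ?_⟩
    rw [← map_mul, hzrs, map_mul, ← hp, ← hq]
    ring
  add_mem' := by
    rintro p q ⟨r, hr, hp⟩ ⟨s, hs, hq⟩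
    exact ⟨r + s, J.add_mem hr hs, by rw [mul_add, hp, hq, map_add]⟩
  algebraMap_mem' c := ⟨a * c, J.mul_mem_right c haJ, (map_mul ..).symm⟩

theorem Ideal.mem_blowupSubalgebra {Q : Type*} [CommRing Q] [Algebra R Q] {J : Ideal R} {a : R}
    {hu : IsUnit (algebraMap R Q a)} {haJ : a ∈ J} {ha : J ^ 2 = Ideal.span {a} * J} {q : Q} :
    q ∈ J.blowupSubalgebra Q hu haJ ha ↔ ∃ r ∈ J, algebraMap R Q a * q = algebraMap R Q r :=
  Iff.rfl

theorem Ideal.finite_blowupSubalgebra [IsNoetherianRing R] {Q : Type*} [CommRing Q] [Algebra R Q]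
    {J : Ideal R} {a : R} (hu : IsUnit (algebraMap R Q a)) (haJ : a ∈ J)
    (ha : J ^ 2 = Ideal.span {a} * J) : Module.Finite R (J.blowupSubalgebra Q hu haJ ha) := by
  let f : J →ₗ[R] Q := LinearMap.mulLeft R (↑hu.unit⁻¹ : Q) ∘ₗ Algebra.linearMap R Q ∘ₗ J.subtype
  have hf : ∀ j, f j ∈ Subalgebra.toSubmodule (J.blowupSubalgebra Q hu haJ ha) := fun j ↦
    ⟨j, j.2, by simp [f, ← mul_assoc]⟩
  refine Module.Finite.of_surjective (LinearMap.codRestrict _ f hf) ?_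
  rintro ⟨q, r, hr, hq⟩
  refine ⟨⟨r, hr⟩, Subtype.ext ?_⟩
  change ↑hu.unit⁻¹ * algebraMap R Q r = q
  rw [← hq, ← mul_assoc, IsUnit.val_inv_mul, one_mul]

/-- Ideals whose images in a ring extension differ by a unit factor are isomorphic. -/
theorem Ideal.nonempty_linearEquiv_of_unit_mul {Q : Type*} [CommRing Q] [Algebra R Q]
    (hinj : Function.Injective (algebraMap R Q)) {I J : Ideal R} (v : Qˣ)
    (hIJ : ∀ i ∈ I, ∃ j ∈ J, v * algebraMap R Q i = algebraMap R Q j)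
    (hJI : ∀ j ∈ J, ∃ i ∈ I, v * algebraMap R Q i = algebraMap R Q j) :
    Nonempty (I ≃ₗ[R] J) := by
  let f : R →ₗ[R] Q := LinearMap.mulLeft R (v : Q) ∘ₗ Algebra.linearMap R Q
  have hf : Function.Injective f := v.isUnit.mul_right_injective.comp hinj
  have heq : Submodule.map f I = Submodule.map (Algebra.linearMap R Q) J := by
    ext q
    constructor
    · rintro ⟨i, hi, rfl⟩
      obtain ⟨j, hj, h⟩ := hIJ i hi
      exact ⟨j, hj, h.symm⟩
    · rintro ⟨j, hj, rfl⟩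
      obtain ⟨i, hi, h⟩ := hJI j hj
      exact ⟨i, hi, h⟩
  exact ⟨Submodule.equivMapOfInjective f hf I ≪≫ₗ LinearEquiv.ofEq _ _ heq ≪≫ₗ
    (Submodule.equivMapOfInjective (Algebra.linearMap R Q) hinj J).symm⟩

theorem mem_traceIdeal_of_linearMap {I : Ideal R} (f : traceIdeal R I →ₗ[R] R)
    (j : traceIdeal R I) : f j ∈ traceIdeal R I := by
  have hmap : (traceIdeal R I) ≤ Submodule.map (traceIdeal R I).subtype
      (Submodule.comap f (traceIdeal R I)) := by
    refine iSup_le fun g ↦ ?_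
    rintro _ ⟨i, rfl⟩
    have hg : ∀ i, g i ∈ traceIdeal R I := fun i ↦
      (le_iSup (fun g : I →ₗ[R] R ↦ LinearMap.range g) g) ⟨i, rfl⟩
    refine ⟨⟨g i, hg i⟩, ?_, rfl⟩
    exact (le_iSup (fun g : I →ₗ[R] R ↦ LinearMap.range g) (f ∘ₗ g.codRestrict _ hg)) ⟨i, rfl⟩
  obtain ⟨y, hy, hyj⟩ := hmap j.2
  rwa [← Subtype.ext hyj]

theorem apply_mem_traceIdeal {M : Type*} [AddCommGroup M] [Module R M] (f : M →ₗ[R] R) (m : M) :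
    f m ∈ traceIdeal R M :=
  (le_iSup (fun g : M →ₗ[R] R ↦ LinearMap.range g) f) ⟨m, rfl⟩

/-- A reflexive ideal is stable under the blowup of a stable trace ideal. -/
theorem Ideal.exists_mul_eq_mul_of_isReflexive {I : Ideal R} [Module.IsReflexive R I] {a : R}
    (ha0 : a ∈ R⁰) (ha : traceIdeal R I ^ 2 = Ideal.span {a} * traceIdeal R I)
    {r x : R} (hr : r ∈ traceIdeal R I) (hx : x ∈ I) : ∃ y ∈ I, a * y = r * x := by
  obtain ⟨g, hg⟩ := LinearMap.exists_mul_eq_of_forall_dvd ha0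
    (r • Module.Dual.eval R I ⟨x, hx⟩) fun f ↦ by
      have h : r * f ⟨x, hx⟩ ∈ traceIdeal R I ^ 2 := by
        rw [pow_two]
        exact Ideal.mul_mem_mul hr (apply_mem_traceIdeal f _)
      rw [ha, Ideal.mem_span_singleton_mul] at h
      obtain ⟨z, -, hz⟩ := h
      exact ⟨z, hz.symm⟩
  obtain ⟨y, rfl⟩ := (Module.bijective_dual_eval R I).2 g
  exact ⟨y, y.2, hg I.subtype⟩

theorem Ideal.mul_apply_comm {I : Ideal R} (f : I →ₗ[R] R) (x y : I) :
    (x : R) * f y = y * f x := by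
  rw [← smul_eq_mul, ← smul_eq_mul, ← map_smul, ← map_smul]
  exact congr_arg f (Subtype.ext (mul_comm ..))

theorem Ideal.nonempty_linearEquiv_traceIdeal [IsNoetherianRing R]
    (hfin : {m : Ideal R | m.IsMaximal}.Finite) {I : Ideal R} [Module.IsReflexive R I]
    (hI : ∃ r ∈ I, r ∈ R⁰) {a : R} (ha0 : a ∈ R⁰) (haJ : a ∈ traceIdeal R I)
    (ha : traceIdeal R I ^ 2 = Ideal.span {a} * traceIdeal R I) :
    Nonempty (I ≃ₗ[R] traceIdeal R I) := by
  obtain ⟨x₀, hx₀, hx₀r⟩ := hI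
  let Q := FractionRing R
  have hinj : Function.Injective (algebraMap R Q) := IsFractionRing.injective R Q
  have hu : IsUnit (algebraMap R Q a) := IsLocalization.map_units Q (⟨a, ha0⟩ : R⁰)
  have hux₀ : IsUnit (algebraMap R Q x₀) := IsLocalization.map_units Q (⟨x₀, hx₀r⟩ : R⁰)
  let B := (traceIdeal R I).blowupSubalgebra Q hu haJ ha
  have : Module.Finite R B := Ideal.finite_blowupSubalgebra hu haJ ha
  have : Finite (MaximalSpectrum B) := by
    have := (Algebra.finite_setOf_isMaximal_of_moduleFinite (S := B) hfin).to_subtype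
    exact .of_injective (fun m ↦ (⟨m.asIdeal, m.isMaximal⟩ : {m : Ideal B | m.IsMaximal}))
      fun m n h ↦ MaximalSpectrum.ext (congr_arg Subtype.val h)
  let IB : Submodule B Q :=
    { carrier := {q | ∃ i ∈ I, q = algebraMap R Q i}
      add_mem' := by
        rintro _ _ ⟨i, hi, rfl⟩ ⟨j, hj, rfl⟩
        exact ⟨i + j, I.add_mem hi hj, (map_add ..).symm⟩
      zero_mem' := ⟨0, I.zero_mem, (map_zero _).symm⟩
      smul_mem' := by
        rintro ⟨b, r, hr, hb⟩ _ ⟨i, hi, rfl⟩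
        obtain ⟨y, hy, hyi⟩ := Ideal.exists_mul_eq_mul_of_isReflexive ha0 ha hr hi
        refine ⟨y, hy, hu.mul_left_cancel ?_⟩
        rw [Subalgebra.smul_def, smul_eq_mul, ← mul_assoc, hb, ← map_mul, ← map_mul, hyi] }
  let D : Submodule B Q := 1 / IB
  have hmem1 : ∀ q : Q, q ∈ (1 : Submodule B Q) ↔ q ∈ B := fun q ↦
    Submodule.mem_one.trans ⟨fun ⟨b, hb⟩ ↦ hb ▸ b.2, fun hq ↦ ⟨⟨q, hq⟩, rfl⟩⟩
  have hone : (1 : Q) ∈ IB * D := by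
    have hle : traceIdeal R I ≤ Submodule.comap
        (LinearMap.mulLeft R (↑hu.unit⁻¹ : Q) ∘ₗ Algebra.linearMap R Q)
        ((IB * D).restrictScalars R) := by
      refine iSup_le fun f ↦ ?_
      rintro _ ⟨i, rfl⟩
      have hf : ∀ j : I, algebraMap R Q (f j) =
          algebraMap R Q j * (↑hux₀.unit⁻¹ * algebraMap R Q (f ⟨x₀, hx₀⟩)) := fun j ↦ by
        refine hux₀.mul_left_cancel ?_
        rw [← map_mul, Ideal.mul_apply_comm f ⟨x₀, hx₀⟩ j, map_mul, mul_left_comm,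
          ← mul_assoc (algebraMap R Q x₀), IsUnit.mul_val_inv, one_mul]
      have hD : ↑hu.unit⁻¹ * (↑hux₀.unit⁻¹ * algebraMap R Q (f ⟨x₀, hx₀⟩)) ∈ D := by
        refine Submodule.mem_div_iff_forall_mul_mem.2 ?_
        rintro _ ⟨j, hj, rfl⟩
        refine (hmem1 _).2 ⟨f ⟨j, hj⟩, apply_mem_traceIdeal f _, ?_⟩
        rw [hf ⟨j, hj⟩, ← mul_assoc, ← mul_assoc, IsUnit.mul_val_inv, one_mul, mul_comm]
      have := Submodule.mul_mem_mul (show algebraMap R Q i ∈ IB from ⟨i, i.2, rfl⟩) hD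
      rw [mul_left_comm, ← hf] at this
      exact this
    simpa using hle haJ
  have hID : IB * D = 1 := le_antisymm Submodule.mul_one_div_le_one
    (Submodule.one_le.2 hone)
  obtain ⟨u, hu'⟩ : Units.mkOfMulEqOne IB D hID ∈
      (Units.map (Submodule.spanSingleton B (A := Q)).toMonoidHom).range := by
    rw [← Submodule.ker_unitsToPic]
    exact Subsingleton.elim _ _
  have hspan : Submodule.span B {(u : Q)} = IB := congr_arg Units.val hu'
  have hv : ∀ q : Q, ↑(hu.unit * u⁻¹) * (q * u) = algebraMap R Q a * q := fun q ↦ by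
    rw [Units.val_mul, IsUnit.unit_spec, mul_assoc, mul_left_comm (↑u⁻¹ : Q), Units.inv_mul, mul_one]
  refine Ideal.nonempty_linearEquiv_of_unit_mul hinj (hu.unit * u⁻¹) (fun i hi ↦ ?_) fun j hj ↦ ?_
  · have hiB : algebraMap R Q i ∈ IB := ⟨i, hi, rfl⟩
    rw [← hspan, Submodule.mem_span_singleton] at hiB
    obtain ⟨⟨b, r, hr, hb⟩, hbi⟩ := hiB
    rw [Subalgebra.smul_def, smul_eq_mul] at hbi
    exact ⟨r, hr, by rw [← hbi, hv, hb]⟩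
  · have hb : algebraMap R Q a * (↑hu.unit⁻¹ * algebraMap R Q j) = algebraMap R Q j := by
      rw [← mul_assoc, IsUnit.mul_val_inv, one_mul]
    have hmem : (⟨_, j, hj, hb⟩ : B) • (u : Q) ∈ IB :=
      hspan ▸ Submodule.smul_mem _ _ (Submodule.mem_span_singleton_self _)
    obtain ⟨i, hi, hiu⟩ := hmem
    rw [Subalgebra.smul_def, smul_eq_mul] at hiu
    exact ⟨i, hi, by rw [← hiu, hv, hb]⟩

theorem Ideal.nonempty_dual_linearEquiv {I : Ideal R} {a : R} (ha0 : a ∈ R⁰)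
    (haJ : a ∈ traceIdeal R I) (ha : traceIdeal R I ^ 2 = Ideal.span {a} * traceIdeal R I)
    (φ : I ≃ₗ[R] traceIdeal R I) : Nonempty ((I →ₗ[R] R) ≃ₗ[R] traceIdeal R I) := by
  let x : I := φ.symm ⟨a, haJ⟩
  have hx : (φ x : R) = a := by simp [x]
  let ev : (I →ₗ[R] R) →ₗ[R] traceIdeal R I :=
    LinearMap.codRestrict _ (Module.Dual.eval R I x) fun f ↦ apply_mem_traceIdeal f x
  have hev : ∀ f, (ev f : R) = f x := fun f ↦ rfl
  have hφ : ∀ i, a • i = (φ i : R) • x := fun i ↦ φ.injective <| Subtype.ext <| by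
    simp [hx, mul_comm]
  refine ⟨LinearEquiv.ofBijective ev ⟨?_, fun r ↦ ?_⟩⟩
  · rw [injective_iff_map_eq_zero]
    intro f hf
    have hfx : f x = 0 := congr_arg Subtype.val hf
    ext i
    refine (mul_cancel_left_mem_nonZeroDivisors ha0).1 ?_
    rw [← smul_eq_mul, ← map_smul, hφ, map_smul, hfx]
    simp
  · obtain ⟨g, hg⟩ := LinearMap.exists_mul_eq_of_forall_dvd ha0
      ((r : R) • (traceIdeal R I).subtype ∘ₗ (φ : I →ₗ[R] traceIdeal R I)) fun i ↦ by
        have h : (r : R) * φ i ∈ traceIdeal R I ^ 2 := by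
          rw [pow_two]
          exact Ideal.mul_mem_mul r.2 (φ i).2
        rw [ha, Ideal.mem_span_singleton_mul] at h
        obtain ⟨z, -, hz⟩ := h
        exact ⟨z, hz.symm⟩
    refine ⟨g, Subtype.ext ((mul_cancel_left_mem_nonZeroDivisors ha0).1 ?_)⟩
    rw [hev, hg]
    simp [hx, mul_comm]

end Blowup

/-- Let `R` be a one-dimensional Cohen-Macaulay semi-local Arf ring and `I` an ideal of
`R` containing a nonzerodivisor that is reflexive as an `R`-module. Then `I` is isomorphic
as an `R`-module to its trace ideal `tr_R(I)`, `I` is isomorphic as an `R`-module to its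
dual `Hom_R(I, R)`, and `tr_R(I)` is an integrally closed ideal of `R`. -/
theorem reflexive_ideal_isom_trace_and_dual {R : Type} [CommRing R]
    (hR : IsOneDimCMSemiLocal R) (hArf : IsArfRing R) (I : Ideal R)
    (hnzd : ∃ x ∈ I, x ∈ nonZeroDivisors R) (hrefl : Module.IsReflexive R ↥I) :
    Nonempty (↥I ≃ₗ[R] ↥(traceIdeal R ↥I)) ∧
    Nonempty (↥I ≃ₗ[R] (↥I →ₗ[R] R)) ∧
    IsIntegrallyClosedIdeal (traceIdeal R ↥I) := by
  have : IsNoetherianRing R := hR.1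
  have htr : ∃ r ∈ traceIdeal R I, r ∈ nonZeroDivisors R :=
    hnzd.imp fun x hx ↦ ⟨apply_mem_traceIdeal I.subtype ⟨x, hx.1⟩, hx.2⟩
  have hcl := hArf.isIntegrallyClosedIdeal htr mem_traceIdeal_of_linearMap
  obtain ⟨a, haJ, ha⟩ := hArf _ hcl htr
  have ha0 := mem_nonZeroDivisors_of_sq_eq_span_mul htr ha
  obtain ⟨φ⟩ := Ideal.nonempty_linearEquiv_traceIdeal hR.2.1 hnzd ha0 haJ ha
  obtain ⟨ψ⟩ := Ideal.nonempty_dual_linearEquiv ha0 haJ ha φ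
  exact ⟨⟨φ⟩, ⟨φ.trans ψ.symm⟩, hcl⟩
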